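/- Let ℂⁿ = H_S ⊕ H_R be an orthogonal decomposition with orthogonal projections Π_S and Π_R = I − Π_S. Let H ∈ M_n(ℂ) be Hermitian, L_1, …, L_r ∈ M_n(ℂ), and set A := −i·H − (1/2)·Σ_k L_k† L_k (the drift matrix of the associated deterministic bilinear control system). Then the subspace H_S is invariant for the master equation (for every density matrix ρ supported in H_S and every t ≥ 0, exp(t𝓛)(ρ) is supported in H_S) if and only if H_S is an invariant subspace for the deterministic system, i.e. Π_R A Π_S = 0 and Π_R L_k Π_S = 0 for every k. -/

import Mathlib

open scoped Matrix ComplexOrder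

noncomputable section

attribute [local instance] Matrix.normedAddCommGroup Matrix.normedSpace

abbrev Mat (n : ℕ) := Matrix (Fin n) (Fin n) ℂ

/-- The Lindblad generator `𝓛(ρ) = −i[H,ρ] + Σ_k (L_k ρ L_k† − ½(L_k† L_k ρ + ρ L_k† L_k))`. -/
def lindblad {n r : ℕ} (H : Mat n) (L : Fin r → Mat n) : Mat n →ₗ[ℂ] Mat n :=
  (-Complex.I) • (LinearMap.mulLeft ℂ H - LinearMap.mulRight ℂ H)
    + ∑ k, ((LinearMap.mulRight ℂ (L k)ᴴ).comp (LinearMap.mulLeft ℂ (L k))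
        - (1/2 : ℂ) • (LinearMap.mulLeft ℂ ((L k)ᴴ * L k)
            + LinearMap.mulRight ℂ ((L k)ᴴ * L k)))

/-- `evol H L t ρ = exp (t 𝓛) ρ`, the solution of the master equation at time `t`. -/
def evol {n r : ℕ} (H : Mat n) (L : Fin r → Mat n) (t : ℝ) (ρ : Mat n) : Mat n :=
  haveI : IsTopologicalRing (Mat n →L[ℂ] Mat n) :=
    @NonUnitalSeminormedRing.toIsTopologicalRing _ (@ContinuousLinearMap.toNormedRing
      ℂ (Mat n) _ _ _).toNonUnitalNormedRing.toNonUnitalSeminormedRing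
  NormedSpace.exp ((t : ℂ) • (lindblad H L).toContinuousLinearMap) ρ

section ExpInvariance

variable {E : Type*} [NormedAddCommGroup E] [NormedSpace ℂ E] [CompleteSpace E]

/-- If `B` preserves the fixed points of `Q`, then so does `exp B`. -/
lemma exp_apply_mem_fixedPoints {B Q : E →L[ℂ] E} (hB : ∀ x, Q x = x → Q (B x) = B x)
    {x : E} (hx : Q x = x) : Q (NormedSpace.exp B x) = NormedSpace.exp B x := by
  have hpow : ∀ m : ℕ, Q ((B ^ m) x) = (B ^ m) x := fun m ↦ by
    induction m with
    | zero => simpa using hx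
    | succ m ih => simpa [pow_succ'] using hB _ ih
  have hsum := (NormedSpace.exp_series_hasSum_exp' (𝕂 := ℂ) B).mapL
    (ContinuousLinearMap.apply ℂ E x)
  have hsumQ := hsum.mapL Q
  have hfix : ∀ m : ℕ, Q (ContinuousLinearMap.apply ℂ E x ((m.factorial : ℂ)⁻¹ • B ^ m))
      = ContinuousLinearMap.apply ℂ E x ((m.factorial : ℂ)⁻¹ • B ^ m) := fun m ↦ by
    rw [ContinuousLinearMap.apply_apply, smul_apply, map_smul, hpow]
  simp only [hfix] at hsumQ
  exact hsumQ.unique hsum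

lemma hasDerivAt_exp_ofReal_smul_apply_zero (B : E →L[ℂ] E) (x : E) :
    HasDerivAt (fun t : ℝ ↦ NormedSpace.exp ((t : ℂ) • B) x) (B x) 0 := by
  have h := hasDerivAt_exp_smul_const (𝕂 := ℂ) B ((0 : ℝ) : ℂ)
  have hreal := HasDerivAt.scomp (0 : ℝ) h Complex.ofRealCLM.hasDerivAt
  have hcomp := ((ContinuousLinearMap.apply ℂ E x).restrictScalars ℝ).hasFDerivAt.comp_hasDerivAt
    (0 : ℝ) hreal
  simpa [Function.comp_def] using hcomp

/-- If the forward orbit of `x` under `exp (t B)` is fixed by `Q`, then so is `B x`. -/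
lemma apply_mem_fixedPoints_of_exp {B Q : E →L[ℂ] E} {x : E}
    (h : ∀ t : ℝ, 0 ≤ t →
      Q (NormedSpace.exp ((t : ℂ) • B) x) = NormedSpace.exp ((t : ℂ) • B) x) :
    Q (B x) = B x := by
  have hd := hasDerivAt_exp_ofReal_smul_apply_zero B x
  have hQ := (Q.restrictScalars ℝ).hasFDerivAt.comp_hasDerivAt (0 : ℝ) hd
  refine (uniqueDiffWithinAt_Ici (0 : ℝ)).eq_deriv _ hQ.hasDerivWithinAt
    (hd.hasDerivWithinAt.congr (fun t ht ↦ h t ht) (h 0 le_rfl))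

end ExpInvariance

/-- The compression `ρ ↦ P ρ P` as a continuous linear map. -/
def compression {n : ℕ} (P : Mat n) : Mat n →L[ℂ] Mat n :=
  ((LinearMap.mulRight ℂ P).comp (LinearMap.mulLeft ℂ P)).toContinuousLinearMap

lemma lindblad_apply_eq_drift {n r : ℕ} {H : Mat n} (hH : H.IsHermitian) (L : Fin r → Mat n)
    {A : Mat n} (hA : A = (-Complex.I) • H - (1/2 : ℂ) • ∑ k, (L k)ᴴ * L k) (ρ : Mat n) :
    lindblad H L ρ = A * ρ + ρ * Aᴴ + ∑ k, L k * ρ * (L k)ᴴ := by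
  have hAd : Aᴴ = Complex.I • H - (1/2 : ℂ) • ∑ k, (L k)ᴴ * L k := by
    simp [hA, Matrix.conjTranspose_sum, hH.eq]
  rw [hAd, hA]
  simp only [lindblad, LinearMap.add_apply, LinearMap.smul_apply, LinearMap.sub_apply,
    LinearMap.sum_apply, LinearMap.comp_apply, LinearMap.mulLeft_apply, LinearMap.mulRight_apply,
    Finset.sum_sub_distrib, ← Finset.smul_sum, Finset.sum_add_distrib, sub_mul, mul_sub,
    smul_mul_assoc, mul_smul_comm, ← Finset.sum_mul, ← Finset.mul_sum]
  module

lemma forall_eq_zero_of_sum_mul_conjTranspose_eq_zero {n r : ℕ} {M : Fin r → Mat n}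
    (h : ∑ k, M k * (M k)ᴴ = 0) (k : Fin r) : M k = 0 := by
  have hpos : ∀ k, (M k * (M k)ᴴ).PosSemidef := fun k ↦
    Matrix.posSemidef_self_mul_conjTranspose _
  have htr : ∑ k, (M k * (M k)ᴴ).trace = 0 := by
    rw [← Matrix.trace_sum, h, Matrix.trace_zero]
  have hk := (Finset.sum_eq_zero_iff_of_nonneg fun k _ ↦ (hpos k).trace_nonneg).1 htr k
    (Finset.mem_univ k)
  exact Matrix.self_mul_conjTranspose_eq_zero.1 ((hpos k).trace_eq_zero_iff.1 hk)

/-- If `𝓛(P)` is supported in the range of `P`, then `P` reduces the drift and noise matrices. -/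
lemma deterministic_invariance_of_drift {n r : ℕ} {P : Mat n} (hPH : P.IsHermitian)
    (hP : P * P = P) {A : Mat n} {L : Fin r → Mat n}
    (h : P * (A * P + P * Aᴴ + ∑ k, L k * P * (L k)ᴴ) * P
      = A * P + P * Aᴴ + ∑ k, L k * P * (L k)ᴴ) :
    (1 - P) * A * P = 0 ∧ ∀ k, (1 - P) * L k * P = 0 := by
  set X := A * P + P * Aᴴ + ∑ k, L k * P * (L k)ᴴ with hX
  have hRP : (1 - P) * P = 0 := by rw [sub_mul, one_mul, hP, sub_self]
  have hPR : P * (1 - P) = 0 := by rw [mul_sub, mul_one, hP, sub_self]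
  have hRX : (1 - P) * X = 0 := by
    rw [← h, ← mul_assoc, ← mul_assoc, hRP, zero_mul, zero_mul]
  have hL : ∀ k, (1 - P) * L k * P = 0 := by
    refine forall_eq_zero_of_sum_mul_conjTranspose_eq_zero ?_
    calc ∑ k, (1 - P) * L k * P * ((1 - P) * L k * P)ᴴ
        = (1 - P) * (∑ k, L k * P * (L k)ᴴ) * (1 - P) := by
          simp only [Finset.mul_sum, Finset.sum_mul]
          refine Finset.sum_congr rfl fun k _ ↦ ?_
          simp only [Matrix.conjTranspose_mul, Matrix.conjTranspose_sub,
            Matrix.conjTranspose_one, hPH.eq]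
          simp only [mul_assoc]
          rw [← mul_assoc P P, hP]
      _ = (1 - P) * X * (1 - P) - (1 - P) * A * (P * (1 - P))
            - ((1 - P) * P) * Aᴴ * (1 - P) := by
          rw [hX]; noncomm_ring
      _ = 0 := by rw [hRX, hPR, hRP]; simp
  refine ⟨?_, hL⟩
  calc (1 - P) * A * P
      = (1 - P) * X - ((1 - P) * P) * Aᴴ - ∑ k, ((1 - P) * L k * P) * (L k)ᴴ := by
        simp only [hX, mul_add, Finset.mul_sum, ← mul_assoc]
        abel
    _ = 0 := by simp [hRX, hRP, hL]

/-- Invariance of the range of `P` under drift and noise gives invariance of the set of matrices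
supported there under `𝓛`. -/
lemma drift_supported_of_deterministic_invariance {n r : ℕ} {P : Mat n} (hPH : P.IsHermitian)
    {A : Mat n} {L : Fin r → Mat n} (hA : (1 - P) * A * P = 0)
    (hL : ∀ k, (1 - P) * L k * P = 0) (hP : P * P = P) {ρ : Mat n} (hρ : P * ρ * P = ρ) :
    P * (A * ρ + ρ * Aᴴ + ∑ k, L k * ρ * (L k)ᴴ) * P
      = A * ρ + ρ * Aᴴ + ∑ k, L k * ρ * (L k)ᴴ := by
  have hPρ : P * ρ = ρ := by rw [← hρ, ← mul_assoc, ← mul_assoc, hP]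
  have hρP : ρ * P = ρ := by rw [← hρ, mul_assoc, hP]
  have left : ∀ M : Mat n, (1 - P) * M * P = 0 → P * (M * ρ) = M * ρ := fun M hM ↦ by
    have : (1 - P) * M * P * ρ = 0 := by rw [hM, zero_mul]
    rw [mul_assoc, hPρ, sub_mul, sub_mul, one_mul, sub_eq_zero] at this
    rw [← mul_assoc, ← this]
  have right : ∀ M : Mat n, (1 - P) * M * P = 0 → ρ * Mᴴ * P = ρ * Mᴴ := fun M hM ↦ by
    have : ρ * ((1 - P) * M * P)ᴴ = 0 := by rw [hM, Matrix.conjTranspose_zero, mul_zero]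
    simp only [Matrix.conjTranspose_mul, Matrix.conjTranspose_sub,
      Matrix.conjTranspose_one, hPH.eq] at this
    rw [← mul_assoc, hρP, mul_sub, mul_sub, mul_one, sub_eq_zero, ← mul_assoc] at this
    exact this.symm
  simp only [mul_add, add_mul, Finset.mul_sum, Finset.sum_mul]
  congr 1
  · congr 1
    · rw [left A hA, mul_assoc, hρP]
    · rw [← mul_assoc, hPρ, right A hA]
  · refine Finset.sum_congr rfl fun k _ ↦ ?_
    rw [← mul_assoc, left _ (hL k), mul_assoc, mul_assoc, ← mul_assoc ρ, right _ (hL k),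
      mul_assoc]

/-- `H_S` is invariant for the master equation iff it is an invariant
subspace for the deterministic system with drift `A = −iH − ½ Σ_k L_k† L_k`, i.e.
`Π_R A Π_S = 0` and `Π_R L_k Π_S = 0` for every `k`. -/
theorem invariance_iff_deterministic_invariance {n r : ℕ}
    (PS : Mat n) (hPH : PS.IsHermitian) (hPidem : PS * PS = PS)
    (H : Mat n) (hH : H.IsHermitian) (L : Fin r → Mat n)
    (A : Mat n) (hA : A = (-Complex.I) • H - (1/2 : ℂ) • ∑ k, (L k)ᴴ * L k) :
    (∀ ρ : Mat n, ρ.PosSemidef → ρ.trace = 1 → PS * ρ * PS = ρ →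
        ∀ t : ℝ, 0 ≤ t → PS * evol H L t ρ * PS = evol H L t ρ) ↔
    ((1 - PS) * A * PS = 0 ∧ ∀ k, (1 - PS) * L k * PS = 0) := by
  have : CompleteSpace (Mat n) := FiniteDimensional.complete ℂ _
  constructor
  · intro h
    have hPpos : PS.PosSemidef := by
      simpa [hPH.eq, hPidem] using Matrix.posSemidef_self_mul_conjTranspose PS
    by_cases hP0 : PS = 0
    · simp [hP0]
    have htr : PS.trace ≠ 0 := fun h0 ↦ hP0 (hPpos.trace_eq_zero_iff.1 h0)
    have hfix := apply_mem_fixedPoints_of_exp (Q := compression PS)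
      (B := (lindblad H L).toContinuousLinearMap)
      (h (PS.trace⁻¹ • PS) (hPpos.smul (inv_nonneg.2 hPpos.trace_nonneg))
        (by simp [htr]) (by simp [hPidem]))
    change PS * lindblad H L (PS.trace⁻¹ • PS) * PS = lindblad H L (PS.trace⁻¹ • PS) at hfix
    rw [map_smul, mul_smul_comm, smul_mul_assoc] at hfix
    have hfix_one := smul_right_injective _ (inv_ne_zero htr) hfix
    rw [lindblad_apply_eq_drift hH L hA] at hfix_one
    exact deterministic_invariance_of_drift hPH hPidem hfix_one
  · rintro ⟨hAP, hLP⟩ ρ - - hρ t -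
    refine exp_apply_mem_fixedPoints (Q := compression PS)
      (B := (t : ℂ) • (lindblad H L).toContinuousLinearMap) (fun x hx ↦ ?_) hρ
    change PS * ((t : ℂ) • lindblad H L x) * PS = (t : ℂ) • lindblad H L x
    rw [mul_smul_comm, smul_mul_assoc, lindblad_apply_eq_drift hH L hA,
      drift_supported_of_deterministic_invariance hPH hAP hLP hPidem hx]
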